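/- arXiv:1808.09359 — 2 statements merged into one kernel-verified Lean document; each statement's English description precedes it below -/
import Mathlib

section
/- Assume m1/m2 > 2. Then for every N ≥ 1, K > 0 and every integer k with ⌊−N/2⌋+1 ≤ k ≤ ⌊N/2⌋, one has |1 − Ω/ω_k^+| ≤ (1/√2)·(m2/m1), where Ω = √(2K(m1+m2)/(m1·m2)). -/
noncomputable section

namespace Diatomic

/-- `Δ_k = m1² + m2² + 2·m1·m2·cos(2πk/N)`. -/
def Δk (N : ℕ) (m1 m2 : ℝ) (k : ℤ) : ℝ :=
  m1 ^ 2 + m2 ^ 2 + 2 * m1 * m2 * Real.cos (2 * Real.pi * k / N)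

/-- Optical branch frequencies `ω_k^+ = (K(m1+m2 + √Δ_k)/(m1·m2))^{1/2}`. -/
def ωplus (N : ℕ) (m1 m2 K : ℝ) (k : ℤ) : ℝ :=
  Real.sqrt (K * (m1 + m2 + Real.sqrt (Δk N m1 m2 k)) / (m1 * m2))

/-- The maximal optical frequency `Ω = ω_0^+ = √(2K(m1+m2)/(m1·m2))`. -/
def Ωmax (m1 m2 K : ℝ) : ℝ := Real.sqrt (2 * K * (m1 + m2) / (m1 * m2))

/-- Range of the mode index `k`: `⌊−N/2⌋+1 ≤ k ≤ ⌊N/2⌋`. -/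
def kRange (N : ℕ) : Finset ℤ := Finset.Icc (Int.fdiv (-(N : ℤ)) 2 + 1) (Int.fdiv (N : ℤ) 2)

lemma Δk_mem_Icc (N : ℕ) {m1 m2 : ℝ} (hm1 : 0 ≤ m1) (hm2 : 0 ≤ m2) (k : ℤ) :
    Δk N m1 m2 k ∈ Set.Icc ((m1 - m2) ^ 2) ((m1 + m2) ^ 2) := by
  have hmul : 0 ≤ 2 * m1 * m2 := by positivity
  have hlow := mul_le_mul_of_nonneg_left (Real.neg_one_le_cos (2 * Real.pi * k / N)) hmul
  have hupp := mul_le_mul_of_nonneg_left (Real.cos_le_one (2 * Real.pi * k / N)) hmul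
  unfold Δk
  constructor <;> linarith

lemma Ωmax_div_ωplus (N : ℕ) {m1 m2 K : ℝ} (hm1 : 0 < m1) (hm2 : 0 < m2) (hK : 0 < K) (k : ℤ) :
    Ωmax m1 m2 K / ωplus N m1 m2 K k =
      Real.sqrt (2 * (m1 + m2) / (m1 + m2 + Real.sqrt (Δk N m1 m2 k))) := by
  have hs := Real.sqrt_nonneg (Δk N m1 m2 k)
  have hsum : m1 + m2 + Real.sqrt (Δk N m1 m2 k) ≠ 0 := by positivity
  rw [Ωmax, ωplus, ← Real.sqrt_div (by positivity)]
  congr 1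
  field_simp

lemma one_le_Ωmax_div_ωplus (N : ℕ) {m1 m2 K : ℝ} (hm1 : 0 < m1) (hm2 : 0 < m2) (hK : 0 < K)
    (k : ℤ) : 1 ≤ Ωmax m1 m2 K / ωplus N m1 m2 K k := by
  have hs : Real.sqrt (Δk N m1 m2 k) ≤ m1 + m2 :=
    Real.sqrt_le_iff.2 ⟨by positivity, (Δk_mem_Icc N hm1.le hm2.le k).2⟩
  rw [Ωmax_div_ωplus N hm1 hm2 hK, Real.one_le_sqrt, one_le_div (by positivity)]
  linarith

lemma Ωmax_div_ωplus_le (N : ℕ) {m1 m2 K : ℝ} (hm1 : 0 < m1) (hm2 : 0 < m2) (hK : 0 < K)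
    (k : ℤ) : Ωmax m1 m2 K / ωplus N m1 m2 K k ≤ 1 + m2 / m1 / 2 := by
  have hs : m1 - m2 ≤ Real.sqrt (Δk N m1 m2 k) :=
    Real.le_sqrt_of_sq_le (Δk_mem_Icc N hm1.le hm2.le k).1
  rw [Ωmax_div_ωplus N hm1 hm2 hK]
  calc Real.sqrt (2 * (m1 + m2) / (m1 + m2 + Real.sqrt (Δk N m1 m2 k)))
      ≤ Real.sqrt (2 * (m1 + m2) / (2 * m1)) := by
        gcongr
        linarith
    _ = Real.sqrt (1 + m2 / m1) := by
        congr 1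
        field_simp
    _ ≤ 1 + m2 / m1 / 2 :=
        Real.sqrt_one_add_le (by linarith [div_pos hm2 hm1])

/-- Assume `m1/m2 > 2`. Then for every `N ≥ 1`, `K > 0` and every mode
index `k` with `⌊−N/2⌋+1 ≤ k ≤ ⌊N/2⌋`, one has `|1 − Ω/ω_k^+| ≤ (1/√2)·(m2/m1)`, where
`Ω = √(2K(m1+m2)/(m1·m2))`. -/
theorem optical_frequency_close_to_Ω (N : ℕ) (hN : 1 ≤ N) (K m1 m2 : ℝ)
    (hK : 0 < K) (hm2 : 0 < m2) (hm : m2 < m1) (hratio : 2 < m1 / m2)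
    (k : ℤ) (hk : k ∈ kRange N) :
    |1 - Ωmax m1 m2 K / ωplus N m1 m2 K k| ≤ (1 / Real.sqrt 2) * (m2 / m1) := by
  have hm1 : 0 < m1 := hm2.trans hm
  have hhalf : 1 / 2 ≤ 1 / Real.sqrt 2 :=
    one_div_le_one_div_of_le (by positivity) (Real.sqrt_le_iff.2 (by norm_num))
  have hmul := mul_le_mul_of_nonneg_right hhalf (div_pos hm2 hm1).le
  have hlow := one_le_Ωmax_div_ωplus N hm1 hm2 hK k
  have hupp := Ωmax_div_ωplus_le N hm1 hm2 hK k
  rw [abs_sub_comm, abs_of_nonneg (sub_nonneg.2 hlow)]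
  linarith

end Diatomic
end
end

section
/- For every N ≥ 1, K > 0, m1 > m2 > 0 and every integer k with ⌊−N/2⌋+1 ≤ k ≤ ⌊N/2⌋ and k ≠ N/2, the eigenvectors u_k^+ and u_k^− satisfy the weighted orthonormality relations ⟨u_k^+, M u_k^+⟩ = 1/N, ⟨u_k^−, M u_k^−⟩ = 1/N and ⟨u_k^+, M u_k^−⟩ = 0, where M = diag(m1, m2). -/
noncomputable section

namespace Diatomic

open Complex

/-- Sign of a branch: `true` is the optical branch `+`, `false` the acoustic branch `−`. -/
def sgn (l : Bool) : ℝ := if l then 1 else -1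

/-- Normalization factor `c_k^± = (N·√Δ_k·(√Δ_k ∓ (m2−m1))/(2m2))^{−1/2}`. -/
def ck (N : ℕ) (m1 m2 : ℝ) (l : Bool) (k : ℤ) : ℝ :=
  (Real.sqrt (N * Real.sqrt (Δk N m1 m2 k) *
      (Real.sqrt (Δk N m1 m2 k) - sgn l * (m2 - m1)) / (2 * m2)))⁻¹

/-- Eigenvectors (for `k ≠ N/2`):
`u_k^± = c_k^±·(cos(πk/N), (m2−m1 ∓ √Δ_k)·e^{iπk/N}/(2m2)) ∈ ℂ²`. -/
def uvec (N : ℕ) (m1 m2 : ℝ) (l : Bool) (k : ℤ) : Fin 2 → ℂ :=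
  ![((ck N m1 m2 l k * Real.cos (Real.pi * k / N) : ℝ) : ℂ),
    ((ck N m1 m2 l k * (m2 - m1 - sgn l * Real.sqrt (Δk N m1 m2 k)) / (2 * m2) : ℝ) : ℂ) *
      Complex.exp (Complex.I * ((Real.pi * k / N : ℝ) : ℂ))]

/-- Hermitian inner product on `ℂ²`. -/
def herm (v w : Fin 2 → ℂ) : ℂ := ∑ i, (starRingEnd ℂ) (v i) * w i

/-- The mass matrix `M = diag(m1, m2)` applied to a vector of `ℂ²`. -/
def massMul (m1 m2 : ℝ) (v : Fin 2 → ℂ) : Fin 2 → ℂ := ![(m1 : ℂ) * v 0, (m2 : ℂ) * v 1]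

/-- In terms of the half angle, `Δ_k = (m2 − m1)² + 4·m1·m2·cos²(πk/N)`. -/
theorem Δk_eq (N : ℕ) (m1 m2 : ℝ) (k : ℤ) :
    Δk N m1 m2 k = (m2 - m1) ^ 2 + 4 * m1 * m2 * Real.cos (Real.pi * k / N) ^ 2 := by
  have h : 2 * Real.pi * k / N = 2 * (Real.pi * k / N) := by ring
  rw [Δk, h, Real.cos_two_mul]
  ring

theorem cos_pos_of_mem_kRange {N : ℕ} (hN : 1 ≤ N) {k : ℤ} (hk : k ∈ kRange N)
    (hk2 : 2 * k ≠ (N : ℤ)) : 0 < Real.cos (Real.pi * k / N) := by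
  rw [kRange, Finset.mem_Icc, Int.fdiv_eq_ediv_of_nonneg _ (by norm_num),
    Int.fdiv_eq_ediv_of_nonneg _ (by norm_num)] at hk
  have hl : -(N : ℤ) < 2 * k := by omega
  have hu : 2 * k < (N : ℤ) := by omega
  have hl' : -(N : ℝ) < 2 * k := by exact_mod_cast hl
  have hu' : 2 * (k : ℝ) < N := by exact_mod_cast hu
  have hN' : (0 : ℝ) < N := by exact_mod_cast hN
  apply Real.cos_pos_of_mem_Ioo
  constructor
  · rw [lt_div_iff₀ hN']
    nlinarith [Real.pi_pos]
  · rw [div_lt_iff₀ hN']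
    nlinarith [Real.pi_pos]

/-- The mass-weighted product of two branches, with the phase `e^{iπk/N}` cancelled. -/
theorem herm_uvec_massMul (N : ℕ) (m1 m2 : ℝ) (l l' : Bool) (k : ℤ) :
    herm (uvec N m1 m2 l k) (massMul m1 m2 (uvec N m1 m2 l' k)) =
      ((ck N m1 m2 l k * ck N m1 m2 l' k * (m1 * Real.cos (Real.pi * k / N) ^ 2 +
        m2 * ((m2 - m1 - sgn l * √(Δk N m1 m2 k)) / (2 * m2)) *
          ((m2 - m1 - sgn l' * √(Δk N m1 m2 k)) / (2 * m2))) : ℝ) : ℂ) := by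
  have hphase : ∀ t : ℝ, (starRingEnd ℂ) (exp (I * t)) * exp (I * t) = 1 := by
    intro t
    rw [← exp_conj, ← exp_add]
    simp
  simp only [herm, massMul, uvec, Fin.sum_univ_two, Matrix.cons_val_zero, Matrix.cons_val_one,
    map_mul, conj_ofReal]
  generalize Real.pi * k / N = t
  have h := hphase t
  push_cast
  linear_combination (ck N m1 m2 l k * (m2 - m1 - sgn l * √(Δk N m1 m2 k)) / (2 * m2) *
    (m2 * (ck N m1 m2 l' k * (m2 - m1 - sgn l' * √(Δk N m1 m2 k)) / (2 * m2))) : ℂ) * h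

theorem herm_uvec_massMul_self {N : ℕ} (hN : 1 ≤ N) {m1 m2 : ℝ} (hm1 : 0 < m1) (hm2 : 0 < m2)
    (l : Bool) {k : ℤ} (hcos : 0 < Real.cos (Real.pi * k / N)) :
    herm (uvec N m1 m2 l k) (massMul m1 m2 (uvec N m1 m2 l k)) = 1 / N := by
  have hN' : (0 : ℝ) < N := by exact_mod_cast hN
  have hΔ := Δk_eq N m1 m2 k
  have hgap : (m2 - m1) ^ 2 < Δk N m1 m2 k := by
    rw [hΔ]
    exact lt_add_of_pos_right _ (by positivity)
  have hs : |m2 - m1| < √(Δk N m1 m2 k) := Real.lt_sqrt_of_sq_lt (by rwa [sq_abs])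
  have hsq : √(Δk N m1 m2 k) ^ 2 = Δk N m1 m2 k :=
    Real.sq_sqrt ((sq_nonneg _).trans hgap.le)
  have hσ : sgn l ^ 2 = 1 := by cases l <;> norm_num [sgn]
  have hdiff : 0 < √(Δk N m1 m2 k) - sgn l * (m2 - m1) := by
    obtain ⟨h1, h2⟩ := abs_lt.mp hs
    cases l <;> simp only [sgn] <;> norm_num <;> linarith
  have hs0 : 0 < √(Δk N m1 m2 k) := (abs_nonneg _).trans_lt hs
  have hc : ck N m1 m2 l k * ck N m1 m2 l k = (N * √(Δk N m1 m2 k) *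
      (√(Δk N m1 m2 k) - sgn l * (m2 - m1)) / (2 * m2))⁻¹ := by
    rw [ck, ← mul_inv, Real.mul_self_sqrt (by positivity)]
  have hquad : m1 * Real.cos (Real.pi * k / N) ^ 2 +
        m2 * ((m2 - m1 - sgn l * √(Δk N m1 m2 k)) / (2 * m2)) *
          ((m2 - m1 - sgn l * √(Δk N m1 m2 k)) / (2 * m2)) =
      √(Δk N m1 m2 k) * (√(Δk N m1 m2 k) - sgn l * (m2 - m1)) / (2 * m2) := by
    field_simp
    linear_combination √(Δk N m1 m2 k) ^ 2 * hσ - hsq - hΔ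
  have hprod : (N * √(Δk N m1 m2 k) * (√(Δk N m1 m2 k) - sgn l * (m2 - m1)) / (2 * m2))⁻¹ *
      (√(Δk N m1 m2 k) * (√(Δk N m1 m2 k) - sgn l * (m2 - m1)) / (2 * m2)) = 1 / (N : ℝ) := by
    have hdiff' := hdiff.ne'
    generalize √(Δk N m1 m2 k) - sgn l * (m2 - m1) = a at hdiff' ⊢
    field_simp
  rw [herm_uvec_massMul, hc, hquad, hprod]
  push_cast
  rfl

theorem herm_uvec_massMul_of_branches (N : ℕ) {m1 m2 : ℝ} (hm1 : 0 < m1) (hm2 : 0 < m2)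
    (k : ℤ) : herm (uvec N m1 m2 true k) (massMul m1 m2 (uvec N m1 m2 false k)) = 0 := by
  have hΔ := Δk_eq N m1 m2 k
  have hsq : √(Δk N m1 m2 k) ^ 2 = Δk N m1 m2 k := Real.sq_sqrt (by rw [hΔ]; positivity)
  have hquad : m1 * Real.cos (Real.pi * k / N) ^ 2 +
        m2 * ((m2 - m1 - sgn true * √(Δk N m1 m2 k)) / (2 * m2)) *
          ((m2 - m1 - sgn false * √(Δk N m1 m2 k)) / (2 * m2)) = 0 := by
    simp only [sgn]
    field_simp
    norm_num
    linear_combination -hsq - hΔ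
  rw [herm_uvec_massMul, hquad, mul_zero, ofReal_zero]

/-- For every `N ≥ 1`, `K > 0`, `m1 > m2 > 0` and every mode index `k`
with `⌊−N/2⌋+1 ≤ k ≤ ⌊N/2⌋`, `k ≠ N/2`, the eigenvectors `u_k^+`, `u_k^−` satisfy the
weighted orthonormality relations `⟨u_k^+, M u_k^+⟩ = 1/N`, `⟨u_k^−, M u_k^−⟩ = 1/N` and
`⟨u_k^+, M u_k^−⟩ = 0`, where `M = diag(m1, m2)`. -/
theorem eigenvector_orthonormality (N : ℕ) (hN : 1 ≤ N) (K m1 m2 : ℝ)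
    (hK : 0 < K) (hm2 : 0 < m2) (hm : m2 < m1)
    (k : ℤ) (hk : k ∈ kRange N) (hk2 : 2 * k ≠ (N : ℤ)) :
    herm (uvec N m1 m2 true k) (massMul m1 m2 (uvec N m1 m2 true k)) = 1 / N ∧
    herm (uvec N m1 m2 false k) (massMul m1 m2 (uvec N m1 m2 false k)) = 1 / N ∧
    herm (uvec N m1 m2 true k) (massMul m1 m2 (uvec N m1 m2 false k)) = 0 := by
  have hm1 : 0 < m1 := hm2.trans hm
  have hcos := cos_pos_of_mem_kRange hN hk hk2
  exact ⟨herm_uvec_massMul_self hN hm1 hm2 true hcos,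
    herm_uvec_massMul_self hN hm1 hm2 false hcos,
    herm_uvec_massMul_of_branches N hm1 hm2 k⟩

end Diatomic
end
end
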